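/- Let n ≥ 2 be an integer and let f be a bounded continuous function on [0,∞) with f ∈ W²_0(ψ), D̃f ∈ W²_0(ψ), and D̃²f ∈ W²(ψ). Then ‖Ṽ_n f − f + λ(n)·D̃²f‖ ≤ θ(n)·‖D̃³f‖, where λ(n) = Σ_{k=n}^∞ 1/(k(k+1)²) and θ(n) = Σ_{k=n}^∞ 1/(k²(k+1)²). -/

import Mathlib

open MeasureTheory Filter Set

/-- Baskakov basis functions `P_{n,k}(x)`, with `P_{n,k} := 0` for `k < 0`. -/
noncomputable def P (n : ℕ) (k : ℤ) (x : ℝ) : ℝ :=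
  if k < 0 then 0
  else (Nat.choose (n + k.toNat - 1) k.toNat : ℝ) * x ^ k.toNat * (1 + x) ^ (-(n : ℤ) - k)

/-- The weight `ψ(x) = x(1+x)`. -/
noncomputable def psi (x : ℝ) : ℝ := x * (1 + x)

/-- The differential operator `D̃ f = ψ f''`. -/
noncomputable def Dt (f : ℝ → ℝ) : ℝ → ℝ := fun x => psi x * deriv (deriv f) x

/-- The functionals `v_{n,k}`. -/
noncomputable def v (n k : ℕ) (f : ℝ → ℝ) : ℝ :=
  if k = 0 then f 0
  else ((n : ℝ) + 1) * ∫ t in Set.Ioi (0 : ℝ), P (n + 2) ((k : ℤ) - 1) t * f t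

/-- The Goodman–Sharma–Baskakov operator `V_n`. -/
noncomputable def V (n : ℕ) (f : ℝ → ℝ) (x : ℝ) : ℝ :=
  ∑' k : ℕ, v n k f * P n (k : ℤ) x

/-- The modified operator `Ṽ_n`. -/
noncomputable def Vt (n : ℕ) (f : ℝ → ℝ) (x : ℝ) : ℝ :=
  ∑' k : ℕ, v n k f * (P n (k : ℤ) x - (1 / (n : ℝ)) * Dt (P n (k : ℤ)) x)

/-- Supremum norm on `[0,∞)`. -/
noncomputable def supNorm (f : ℝ → ℝ) : ℝ := ⨆ x ∈ Set.Ici (0 : ℝ), |f x|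

/-- `f` is bounded and continuous on `[0,∞)`. -/
def BddContOn (f : ℝ → ℝ) : Prop :=
  ContinuousOn f (Set.Ici 0) ∧ ∃ M, ∀ x ∈ Set.Ici (0 : ℝ), |f x| ≤ M

/-- The space `W²(ψ)`: `g, g'` (locally) differentiable on `(0,∞)` and `D̃ g` bounded. -/
def MemW2 (g : ℝ → ℝ) : Prop :=
  DifferentiableOn ℝ g (Set.Ioi 0) ∧ DifferentiableOn ℝ (deriv g) (Set.Ioi 0) ∧
    ∃ M, ∀ x ∈ Set.Ioi (0 : ℝ), |Dt g x| ≤ M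

/-- The space `W²₀(ψ)`: members of `W²(ψ)` with `D̃ g(x) → 0` as `x → 0⁺`. -/
def MemW20 (g : ℝ → ℝ) : Prop :=
  MemW2 g ∧ Filter.Tendsto (Dt g) (nhdsWithin 0 (Set.Ioi 0)) (nhds 0)

/-- The K-functional `K(f,t)`. -/
noncomputable def Kfun (f : ℝ → ℝ) (t : ℝ) : ℝ :=
  sInf {a : ℝ | ∃ g : ℝ → ℝ, MemW20 g ∧ MemW2 (Dt g) ∧
    a = supNorm (fun x => f x - g x) + t * supNorm (Dt (Dt g))}

/-- The function `T_{n,k}(x)`. -/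
noncomputable def T (n : ℕ) (k : ℤ) (x : ℝ) : ℝ :=
  (k : ℝ) * ((k : ℝ) - 1) * (1 + x) / x - 2 * (k : ℝ) * ((n : ℝ) + (k : ℝ))
    + ((n : ℝ) + (k : ℝ)) * ((n : ℝ) + (k : ℝ) + 1) * x / (1 + x)

lemma P_natCast (m k : ℕ) (x : ℝ) :
    P (m + 1) (k : ℤ) x = ((m + k).choose k : ℝ) * x ^ k * ((1 + x) ^ (m + 1 + k))⁻¹ := by
  have h : ¬ ((k : ℤ) < 0) := by omega
  have e : -((m + 1 : ℕ) : ℤ) - (k : ℤ) = -((m + 1 + k : ℕ) : ℤ) := by push_cast; ring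
  simp only [P, if_neg h, Int.toNat_natCast]
  rw [e, zpow_neg, zpow_natCast, show m + 1 + k - 1 = m + k by omega]

lemma P_of_neg (n : ℕ) {k : ℤ} (hk : k < 0) (x : ℝ) : P n k x = 0 := by simp [P, hk]

lemma P_nonneg (n : ℕ) (k : ℤ) {x : ℝ} (hx : 0 ≤ x) : 0 ≤ P n k x := by
  unfold P; split_ifs <;> positivity

lemma one_add_mul_P_succ (m : ℕ) (k : ℤ) {x : ℝ} (hx : -1 < x) :
    ((m : ℝ) + 1) * ((1 + x) * P (m + 2) k x) = (m + 1 + k) * P (m + 1) k x := by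
  have hx' : (1 + x) ≠ 0 := by linarith
  rcases lt_or_ge k 0 with hk | hk
  · simp [P_of_neg _ hk]
  · lift k to ℕ using hk
    rw [P_natCast (m + 1), P_natCast m]
    have h := Nat.choose_mul_succ_eq (m + k) k
    rw [show m + k + 1 - k = m + 1 by omega] at h
    have h' : ((m + k).choose k : ℝ) * (m + k + 1) = ((m + k + 1).choose k) * (m + 1) := by
      exact_mod_cast h
    rw [show m + 1 + k = m + k + 1 by omega, show m + 1 + 1 + k = m + k + 1 + 1 by omega]
    have e : ((1 + x) ^ (m + k + 1 + 1))⁻¹ * (1 + x) = ((1 + x) ^ (m + k + 1))⁻¹ := by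
      rw [pow_succ]; field_simp
    rw [← e]
    push_cast
    linear_combination (-x ^ k * ((1 + x) ^ (m + k + 1 + 1))⁻¹ * (1 + x)) * h'

lemma mul_P_succ (m : ℕ) (k : ℤ) (x : ℝ) :
    ((m : ℝ) + 1) * (x * P (m + 2) k x) = (k + 1) * P (m + 1) (k + 1) x := by
  rcases lt_trichotomy k (-1) with hk | rfl | hk
  · simp [P_of_neg _ (show k < 0 by omega), P_of_neg _ (show k + 1 < 0 by omega)]
  · simp [P_of_neg]
  · lift k to ℕ using by omega
    rw [show (k : ℤ) + 1 = ((k + 1 : ℕ) : ℤ) by push_cast; rfl, P_natCast (m + 1), P_natCast m]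
    have h := Nat.choose_succ_right_eq (m + 1 + k) k
    rw [show m + 1 + k - k = m + 1 by omega] at h
    have h' : ((m + 1 + k).choose (k + 1) : ℝ) * (k + 1) = ((m + 1 + k).choose k) * (m + 1) := by
      exact_mod_cast h
    rw [show m + (k + 1) = m + 1 + k by omega, show m + 1 + 1 + k = m + 1 + (k + 1) by omega]
    push_cast
    linear_combination (-x ^ (k + 1) * ((1 + x) ^ (m + 1 + (k + 1)))⁻¹) * h'

lemma P_succ_eq (m : ℕ) (k : ℤ) {x : ℝ} (hx : -1 < x) :
    ((m : ℝ) + 1) * P (m + 2) k x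
      = (m + 1 + k) * P (m + 1) k x - (k + 1) * P (m + 1) (k + 1) x := by
  linear_combination one_add_mul_P_succ m k hx - mul_P_succ m k x

lemma psi_mul_P (m : ℕ) (k : ℤ) {x : ℝ} (hx : -1 < x) :
    ((m : ℝ) + 1) * (m + 2) * (psi x * P (m + 3) k x)
      = (k + 1) * (m + 2 + k) * P (m + 1) (k + 1) x := by
  have h1 := one_add_mul_P_succ (m + 1) k hx
  have h2 := mul_P_succ m k x
  push_cast at h1
  unfold psi
  linear_combination (m + 1) * x * h1 + (m + 2 + k) * h2

lemma hasDerivAt_P (m : ℕ) (k : ℤ) {x : ℝ} (hx : -1 < x) :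
    HasDerivAt (P (m + 1) k) ((m + 1) * (P (m + 2) (k - 1) x - P (m + 2) k x)) x := by
  have hx' : (1 + x) ≠ 0 := by linarith
  rcases lt_or_ge k 0 with hk | hk
  · rw [P_of_neg _ hk, P_of_neg _ (show k - 1 < 0 by omega),
      show P (m + 1) k = fun _ => 0 from funext fun x => P_of_neg _ hk x]
    simpa using hasDerivAt_const x (0 : ℝ)
  · lift k to ℕ using hk
    have hQ : HasDerivAt (P (m + 1) k)
        (((m + k).choose k : ℝ) * (k * x ^ (k - 1)) * ((1 + x) ^ (m + 1 + k))⁻¹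
          + ((m + k).choose k : ℝ) * x ^ k *
            (-((m + 1 + k : ℕ) * (1 + x) ^ (m + k)) / ((1 + x) ^ (m + 1 + k)) ^ 2)) x := by
      rw [show P (m + 1) k = fun x : ℝ =>
        ((m + k).choose k : ℝ) * x ^ k * ((1 + x) ^ (m + 1 + k))⁻¹ from funext (P_natCast m k)]
      have h1 : HasDerivAt (fun y : ℝ => (1 + y) ^ (m + 1 + k))
          ((m + 1 + k : ℕ) * (1 + x) ^ (m + k)) x := by
        have := ((hasDerivAt_id x).const_add 1).pow (m + 1 + k)
        simpa [show m + 1 + k - 1 = m + k by omega, Pi.pow_def] using this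
      exact ((hasDerivAt_pow k x).const_mul _).mul (h1.inv (pow_ne_zero _ hx'))
    convert hQ using 1
    have e1 : (-((m + 1 + k : ℕ) * (1 + x) ^ (m + k)) / ((1 + x) ^ (m + 1 + k)) ^ 2)
        = -((m + 1 + k : ℕ) * ((1 + x) ^ (m + 2 + k))⁻¹) := by
      field_simp
      ring
    have e2 := one_add_mul_P_succ m k hx
    have e3 : ((m : ℝ) + 1) * P (m + 2) k x
        = ((m + k).choose k : ℝ) * x ^ k * ((m + 1 + k : ℕ) * ((1 + x) ^ (m + 2 + k))⁻¹) := by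
      rw [P_natCast m k] at e2
      have : ((m : ℝ) + 1) * P (m + 2) k x = (((m : ℝ) + 1) * ((1 + x) * P (m + 2) k x)) / (1 + x) := by
        field_simp
      rw [this, e2]
      push_cast
      field_simp
      ring
    have e4 : ((m : ℝ) + 1) * P (m + 2) (k - 1) x
        = ((m + k).choose k : ℝ) * (k * x ^ (k - 1)) * ((1 + x) ^ (m + 1 + k))⁻¹ := by
      rcases k with _ | k
      · simp [P_of_neg]
      · rw [show ((k + 1 : ℕ) : ℤ) - 1 = (k : ℤ) by push_cast; ring, P_natCast (m + 1)]
        have h := Nat.choose_succ_right_eq (m + 1 + k) k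
        rw [show m + 1 + k - k = m + 1 by omega] at h
        have h' : ((m + 1 + k).choose (k + 1) : ℝ) * (k + 1)
            = ((m + 1 + k).choose k) * (m + 1) := by
          exact_mod_cast h
        rw [show m + (k + 1) = m + 1 + k by omega, show m + 1 + 1 + k = m + 1 + (k + 1) by omega]
        rw [Nat.add_sub_cancel]
        push_cast
        linear_combination (-x ^ k * ((1 + x) ^ (m + 1 + (k + 1)))⁻¹) * h'
    rw [e1, mul_sub, e3, e4]
    ring

lemma hasDerivAt_deriv_P (m : ℕ) (k : ℤ) {x : ℝ} (hx : -1 < x) :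
    HasDerivAt (deriv (P (m + 1) k)) ((m + 1) * (m + 2) *
      (P (m + 3) (k - 2) x - 2 * P (m + 3) (k - 1) x + P (m + 3) k x)) x := by
  have h1 := ((hasDerivAt_P (m + 1) (k - 1) hx).sub (hasDerivAt_P (m + 1) k hx)).const_mul
    ((m : ℝ) + 1)
  have h2 : deriv (P (m + 1) k) =ᶠ[nhds x]
      fun y => ((m : ℝ) + 1) * (P (m + 2) (k - 1) y - P (m + 2) k y) := by
    filter_upwards [Ioi_mem_nhds hx] with y hy using (hasDerivAt_P m k hy).deriv
  refine (h1.congr_of_eventuallyEq h2).congr_deriv ?_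
  rw [show k - 1 - 1 = k - 2 by ring]
  push_cast
  ring

lemma Dt_P (m : ℕ) (k : ℤ) {x : ℝ} (hx : -1 < x) :
    Dt (P (m + 1) k) x = (k - 1) * (m + k) * P (m + 1) (k - 1) x
      - 2 * (k * (m + 1 + k)) * P (m + 1) k x
      + (k + 1) * (m + 2 + k) * P (m + 1) (k + 1) x := by
  rw [Dt, (hasDerivAt_deriv_P m k hx).deriv]
  have h0 := psi_mul_P m (k - 2) hx
  have h1 := psi_mul_P m (k - 1) hx
  have h2 := psi_mul_P m k hx
  rw [show k - 2 + 1 = k - 1 by ring] at h0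
  rw [show k - 1 + 1 = k by ring] at h1
  push_cast at h0 h1
  linear_combination h0 - 2 * h1 + h2

lemma hasSum_P (m : ℕ) {x : ℝ} (hx : 0 ≤ x) : HasSum (fun k : ℕ => P (m + 1) k x) 1 := by
  have hx1 : (1 + x) ≠ 0 := by linarith
  have hr : ‖x / (1 + x)‖ < 1 := by
    rw [Real.norm_eq_abs, abs_of_nonneg (by positivity), div_lt_one (by linarith)]
    linarith
  have h := (hasSum_choose_mul_geometric_of_norm_lt_one m hr).mul_right (((1 + x) ^ (m + 1))⁻¹)
  have e : 1 - x / (1 + x) = (1 + x)⁻¹ := by field_simp; ring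
  rw [e] at h
  convert! h using 1
  · funext k
    rw [P_natCast, show (m + k).choose k = (k + m).choose m by
      rw [add_comm m k, Nat.choose_symm_add], div_pow, pow_add _ (m + 1) k]
    field_simp
  · rw [inv_pow, one_div, inv_inv, mul_inv_cancel₀ (pow_ne_zero _ hx1)]

lemma P_succ_zero (m k : ℕ) : P (m + 1) ((k + 1 : ℕ) : ℤ) 0 = 0 := by
  rw [P_natCast]; simp

lemma hasSum_natCast_mul_P (m : ℕ) {x : ℝ} (hx : 0 ≤ x) :
    HasSum (fun k : ℕ => (k : ℝ) * P (m + 1) k x) ((m + 1) * x) := by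
  have h := (hasSum_P (m + 1) hx).mul_left ((m + 1) * x)
  rw [← hasSum_nat_add_iff' 1]
  convert! h using 1
  · funext k
    have := mul_P_succ m k x
    push_cast at this ⊢
    linarith
  · simp

lemma hasSum_natCast_mul_succ_mul_P (m : ℕ) {x : ℝ} (hx : 0 ≤ x) :
    HasSum (fun k : ℕ => (k : ℝ) * (k + 1) * P (m + 1) k x)
      ((m + 1) * (m + 2) * x ^ 2 + 2 * (m + 1) * x) := by
  have h := (((hasSum_natCast_mul_P (m + 1) hx)).add ((hasSum_P (m + 1) hx).mul_left 2)).mul_left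
    ((m + 1) * x)
  rw [← hasSum_nat_add_iff' 1]
  convert! h using 1
  · funext k
    have := mul_P_succ m k x
    push_cast at this ⊢
    linear_combination -(k + 2 : ℝ) * this
  · push_cast; simp; ring

lemma continuousOn_P (m : ℕ) (k : ℤ) : ContinuousOn (P (m + 1) k) (Ioi (-1)) :=
  fun _ hx => (hasDerivAt_P m k hx).continuousAt.continuousWithinAt

lemma P_le (m k : ℕ) {x : ℝ} (hx : 0 ≤ x) :
    P (m + 1) k x ≤ ((m + k).choose k : ℝ) * P (m + 1) 0 x := by
  have h0 := P_natCast m 0 x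
  simp only [Nat.cast_zero] at h0
  rw [P_natCast, h0, pow_add _ (m + 1) k]
  have : x ^ k ≤ (1 + x) ^ k := by gcongr; linarith
  simp only [add_zero, Nat.choose_zero_right, Nat.cast_one, pow_zero, mul_one, one_mul]
  rw [mul_assoc]
  gcongr
  rw [mul_inv, mul_comm, mul_assoc]
  refine mul_le_of_le_one_right (by positivity) ?_
  rw [inv_mul_le_iff₀ (by positivity)]
  linarith

lemma tendsto_P_atTop (m : ℕ) (k : ℤ) : Tendsto (P (m + 1) k) atTop (nhds 0) := by
  rcases lt_or_ge k 0 with hk | hk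
  · rw [show P (m + 1) k = fun _ => 0 from funext fun x => P_of_neg _ hk x]
    exact tendsto_const_nhds
  · lift k to ℕ using hk
    have h0 : Tendsto (P (m + 1) 0) atTop (nhds 0) := by
      have : P (m + 1) 0 = fun x => ((1 + x) ^ (m + 1))⁻¹ := by
        funext x
        have h0 := P_natCast m 0 x
        simp only [Nat.cast_zero] at h0
        simp [h0]
      rw [this]
      exact tendsto_inv_atTop_zero.comp
        ((tendsto_pow_atTop (by omega)).comp (tendsto_atTop_add_const_left _ _ tendsto_id))
    have h1 := h0.const_mul ((m + k).choose k : ℝ)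
    rw [mul_zero] at h1
    refine squeeze_zero' ?_ ?_ h1
    · filter_upwards [eventually_ge_atTop 0] with x hx using P_nonneg _ _ hx
    · filter_upwards [eventually_ge_atTop 0] with x hx using P_le m k hx

lemma P_zero_zero (m : ℕ) : P (m + 1) 0 0 = 1 := by
  have h0 := P_natCast m 0 0
  simp only [Nat.cast_zero] at h0
  simp [h0]

lemma integrableOn_P (m : ℕ) (k : ℤ) : IntegrableOn (P (m + 2) k) (Ioi 0) := by
  rcases lt_or_ge k 0 with hk | hk
  · rw [show P (m + 2) k = fun _ => 0 from funext fun x => P_of_neg _ hk x]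
    exact integrableOn_zero
  · lift k to ℕ using hk
    have h0 : IntegrableOn (fun x => ((m : ℝ) + 1) * P (m + 2) 0 x) (Ioi 0) := by
      refine integrableOn_Ioi_deriv_of_nonneg' (g := fun x => -P (m + 1) 0 x) (l := -0) ?_ ?_
        (tendsto_P_atTop m 0).neg
      · intro x hx
        have := (hasDerivAt_P m 0 (x := x) (by simp at hx; linarith)).neg
        rw [P_of_neg (m + 2) (show (0 - 1 : ℤ) < 0 by norm_num)] at this
        exact this.congr_deriv (by ring)
      · intro x hx
        exact mul_nonneg (by positivity) (P_nonneg _ _ (le_of_lt hx))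
    have h1 : IntegrableOn (fun x => ((m + 1 + k).choose k : ℝ) * P (m + 2) 0 x) (Ioi 0) := by
      refine (h0.const_mul (((m + 1 + k).choose k : ℝ) / (m + 1))).congr ?_
      refine ae_of_all _ fun x => ?_
      field_simp
    refine Integrable.mono' h1 ?_ ?_
    · exact ((continuousOn_P (m + 1) k).mono (Ioi_subset_Ioi (by norm_num))).aestronglyMeasurable
        measurableSet_Ioi
    · filter_upwards [ae_restrict_mem measurableSet_Ioi] with x hx
      rw [Real.norm_eq_abs, abs_of_nonneg (P_nonneg _ _ (le_of_lt hx))]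
      exact P_le (m + 1) k (le_of_lt hx)

lemma integral_P (m k : ℕ) : ∫ t in Ioi (0 : ℝ), P (m + 2) k t = 1 / (m + 1) := by
  have hsub (k : ℕ) : ((m : ℝ) + 1) * ((∫ t in Ioi (0 : ℝ), P (m + 2) ((k : ℤ) - 1) t)
      - ∫ t in Ioi (0 : ℝ), P (m + 2) k t) = - P (m + 1) k 0 := by
    rw [← integral_sub (integrableOn_P _ _) (integrableOn_P _ _), ← integral_const_mul,
      integral_Ioi_of_hasDerivAt_of_tendsto'
        (fun x hx => hasDerivAt_P m k (x := x) (by simp at hx; linarith))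
        (((integrableOn_P m _).sub (integrableOn_P m _)).const_mul _) (tendsto_P_atTop m k)]
    ring
  induction k with
  | zero =>
    have h := hsub 0
    simp only [P_of_neg (m + 2) (show ((0 : ℕ) - 1 : ℤ) < 0 by norm_num), integral_zero] at h
    simp only [Nat.cast_zero, P_zero_zero] at h
    rw [Nat.cast_zero, eq_div_iff (by positivity)]
    linarith
  | succ k ih =>
    have h := hsub (k + 1)
    rw [P_succ_zero, show ((k + 1 : ℕ) : ℤ) - 1 = (k : ℤ) by push_cast; ring, ih] at h
    have : ((m : ℝ) + 1) ≠ 0 := by positivity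
    rw [neg_zero, mul_eq_zero] at h
    rcases h with h | h
    · exact absurd h this
    · linarith

lemma v_zero (n : ℕ) (g : ℝ → ℝ) : v n 0 g = g 0 := by simp [v]

lemma v_succ (m k : ℕ) (g : ℝ → ℝ) :
    v (m + 1) (k + 1) g = (m + 2) * ∫ t in Ioi (0 : ℝ), P (m + 3) k t * g t := by
  rw [v, if_neg (by omega), show ((k + 1 : ℕ) : ℤ) - 1 = (k : ℤ) by push_cast; ring]
  push_cast
  ring_nf

/-- Measurability on the half-line, with an explicit bound. -/
structure MeasBdd (g : ℝ → ℝ) (M : ℝ) : Prop where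
  meas : AEStronglyMeasurable g (volume.restrict (Ioi 0))
  le : ∀ x, 0 ≤ x → |g x| ≤ M

lemma MeasBdd.nonneg {g : ℝ → ℝ} {M : ℝ} (hg : MeasBdd g M) : 0 ≤ M :=
  (abs_nonneg _).trans (hg.le 0 le_rfl)

lemma MeasBdd.integrableOn {g : ℝ → ℝ} {M : ℝ} (hg : MeasBdd g M) (m : ℕ) (k : ℤ) :
    IntegrableOn (fun t => P (m + 2) k t * g t) (Ioi 0) := by
  refine Integrable.mul_bdd (c := M) (integrableOn_P m k) hg.meas ?_
  filter_upwards [ae_restrict_mem measurableSet_Ioi] with x hx using hg.le x (le_of_lt hx)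

lemma MeasBdd.abs_v_le {g : ℝ → ℝ} {M : ℝ} (hg : MeasBdd g M) (m k : ℕ) :
    |v (m + 1) k g| ≤ M := by
  rcases k with _ | k
  · rw [v_zero]; exact hg.le 0 le_rfl
  · rw [v_succ, abs_mul, abs_of_nonneg (by positivity : (0 : ℝ) ≤ m + 2)]
    have h1 : |∫ t in Ioi (0 : ℝ), P (m + 3) k t * g t| ≤ ∫ t in Ioi (0 : ℝ), P (m + 3) k t * M := by
      rw [← Real.norm_eq_abs]
      refine norm_integral_le_of_norm_le ((integrableOn_P (m + 1) k).mul_const M) ?_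
      filter_upwards [ae_restrict_mem measurableSet_Ioi] with x hx
      have h0 := P_nonneg (m + 3) k (le_of_lt hx)
      rw [norm_mul, Real.norm_eq_abs, abs_of_nonneg h0]
      exact mul_le_mul_of_nonneg_left (hg.le x (le_of_lt hx)) h0
    rw [integral_mul_const, integral_P (m + 1) k] at h1
    calc ((m : ℝ) + 2) * _ ≤ (m + 2) * (1 / ((m + 1 : ℕ) + 1) * M) := by gcongr
      _ = M := by push_cast; field_simp; ring

lemma MeasBdd.v_succ_left {g : ℝ → ℝ} {M : ℝ} (hg : MeasBdd g M) (m k : ℕ) :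
    ((m : ℝ) + 2) * v (m + 2) k g
      = (m + 2 + k) * v (m + 1) k g - k * v (m + 1) (k + 1) g := by
  rcases k with _ | k
  · simp [v_zero]
  · have hI : ((m : ℝ) + 3) * ∫ t in Ioi (0 : ℝ), P (m + 4) k t * g t
        = (m + 3 + k) * (∫ t in Ioi (0 : ℝ), P (m + 3) k t * g t)
          - (k + 1) * ∫ t in Ioi (0 : ℝ), P (m + 3) (k + 1 : ℕ) t * g t := by
      rw [← integral_const_mul, ← integral_const_mul, ← integral_const_mul,
        ← integral_sub ((hg.integrableOn (m + 1) _).const_mul _)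
          ((hg.integrableOn (m + 1) _).const_mul _)]
      refine setIntegral_congr_fun measurableSet_Ioi fun t ht => ?_
      have := P_succ_eq (m + 2) k (x := t) (by simp at ht; linarith)
      push_cast at this ⊢
      linear_combination g t * this
    have h3 := v_succ (m + 1) k g
    push_cast at h3
    rw [h3, v_succ, v_succ]
    push_cast at hI ⊢
    linear_combination (m + 2 : ℝ) * hI

lemma MemW2.abs_deriv_le {g : ℝ → ℝ} (hw : MemW2 g) :
    ∃ A M : ℝ, ∀ t, 0 < t → |deriv g t| ≤ A + M * |Real.log t| := by
  obtain ⟨-, hd, M, hM⟩ := hw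
  have hM0 : 0 ≤ M := (abs_nonneg _).trans (hM 1 (by simp))
  have hder (t : ℝ) (ht : 0 < t) : HasDerivAt (deriv g) (deriv (deriv g) t) t :=
    (hd.differentiableAt (Ioi_mem_nhds ht)).hasDerivAt
  have hlog (t : ℝ) (ht : 0 < t) : HasDerivAt (fun t => M * Real.log t) (M / t) t := by
    simpa [div_eq_mul_inv] using (Real.hasDerivAt_log ht.ne').const_mul M
  have hbound (t : ℝ) (ht : 0 < t) : |deriv (deriv g) t| ≤ M / t := by
    have h1 := hM t ht
    rw [Dt, psi, abs_mul, abs_of_pos (by positivity)] at h1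
    rw [le_div_iff₀ ht]
    nlinarith [mul_nonneg (mul_nonneg ht.le ht.le) (abs_nonneg (deriv (deriv g) t))]
  have hmono (F F' : ℝ → ℝ) (hF : ∀ t, 0 < t → HasDerivAt F (F' t) t)
      (hF' : ∀ t, 0 < t → 0 ≤ F' t) : MonotoneOn F (Ioi 0) := by
    refine monotoneOn_of_deriv_nonneg (convex_Ioi 0)
      (fun t ht => (hF t ht).continuousAt.continuousWithinAt)
      (fun t ht => ?_) (fun t ht => ?_)
    · rw [interior_Ioi] at ht ⊢
      exact (hF t ht).differentiableAt.differentiableWithinAt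
    · rw [interior_Ioi] at ht
      rw [(hF t ht).deriv]
      exact hF' t ht
  have m1 := hmono _ _ (fun t ht => (hlog t ht).add (hder t ht))
    (fun t ht => by have := abs_le.1 (hbound t ht); linarith)
  have m2 := hmono _ _ (fun t ht => (hlog t ht).sub (hder t ht))
    (fun t ht => by have := abs_le.1 (hbound t ht); linarith)
  refine ⟨|deriv g 1|, M, fun t ht => ?_⟩
  have h1 : (1 : ℝ) ∈ Ioi (0 : ℝ) := by simp
  have habs := abs_le.1 (le_refl |deriv g 1|)
  rcases le_total t 1 with h | h
  · have a1 := m1 ht h1 h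
    have a2 := m2 ht h1 h
    simp only [Pi.add_apply, Pi.sub_apply, Real.log_one] at a1 a2
    rw [abs_of_nonpos (Real.log_nonpos ht.le h), abs_le]
    constructor <;> linarith
  · have a1 := m1 h1 ht h
    have a2 := m2 h1 ht h
    simp only [Pi.add_apply, Pi.sub_apply, Real.log_one] at a1 a2
    rw [abs_of_nonneg (Real.log_nonneg h), abs_le]
    constructor <;> linarith

lemma P_succ_le_mul (m k : ℕ) {x : ℝ} (hx : 0 ≤ x) :
    P (m + 1) (k + 1 : ℕ) x ≤ ((m + (k + 1)).choose (k + 1) : ℝ) * x := by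
  rw [P_natCast, mul_assoc]
  gcongr
  rw [← div_eq_mul_inv, div_le_iff₀ (by positivity), pow_succ, mul_comm]
  gcongr
  calc x ^ k ≤ (1 + x) ^ k := by gcongr; linarith
    _ ≤ (1 + x) ^ (m + 1 + (k + 1)) := pow_le_pow_right₀ (by linarith) (by omega)

lemma P_succ_le_div (m k : ℕ) {x : ℝ} (hx : 0 < x) :
    P (m + 1) (k + 1 : ℕ) x ≤ ((m + (k + 1)).choose (k + 1) : ℝ) * x⁻¹ := by
  rw [P_natCast, mul_assoc]
  gcongr
  rw [← div_eq_mul_inv, div_le_iff₀ (by positivity), inv_mul_eq_div, le_div_iff₀ hx, ← pow_succ]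
  calc x ^ (k + 1 + 1) ≤ (1 + x) ^ (k + 1 + 1) := by gcongr; linarith
    _ ≤ (1 + x) ^ (m + 1 + (k + 1)) := pow_le_pow_right₀ (by linarith) (by omega)

lemma MemW2.tendsto_P_mul_deriv_nhdsGT {g : ℝ → ℝ} (hw : MemW2 g) (m k : ℕ) :
    Tendsto (fun t => P (m + 1) (k + 1 : ℕ) t * deriv g t) (nhdsWithin 0 (Ioi 0)) (nhds 0) := by
  obtain ⟨A, M, h⟩ := hw.abs_deriv_le
  set C := ((m + (k + 1)).choose (k + 1) : ℝ)
  have hid : Tendsto (fun t : ℝ => t) (nhdsWithin 0 (Ioi 0)) (nhds 0) :=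
    tendsto_nhdsWithin_of_tendsto_nhds tendsto_id
  have hlog : Tendsto (fun t : ℝ => |t * Real.log t|) (nhdsWithin 0 (Ioi 0)) (nhds 0) := by
    have := (Real.continuous_mul_log.tendsto 0).mono_left (nhdsWithin_le_nhds (s := Ioi 0))
    simpa using this.abs
  have hlim := ((hid.const_mul A).add (hlog.const_mul M)).const_mul C
  simp only [mul_zero, add_zero] at hlim
  refine squeeze_zero_norm' ?_ hlim
  filter_upwards [self_mem_nhdsWithin] with t ht
  have ht' : 0 < t := ht
  have hP := P_nonneg (m + 1) (k + 1 : ℕ) ht'.le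
  rw [norm_mul, Real.norm_eq_abs, Real.norm_eq_abs, abs_of_nonneg hP]
  calc _ ≤ (C * t) * (A + M * |Real.log t|) :=
        mul_le_mul (P_succ_le_mul m k ht'.le) (h t ht') (abs_nonneg _) (by positivity)
    _ = _ := by rw [abs_mul, abs_of_pos ht']; ring

lemma MemW2.tendsto_P_mul_deriv_atTop {g : ℝ → ℝ} (hw : MemW2 g) (m k : ℕ) :
    Tendsto (fun t => P (m + 1) (k + 1 : ℕ) t * deriv g t) atTop (nhds 0) := by
  obtain ⟨A, M, h⟩ := hw.abs_deriv_le
  set C := ((m + (k + 1)).choose (k + 1) : ℝ)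
  have hlog : Tendsto (fun t : ℝ => |Real.log t / t|) atTop (nhds 0) := by
    have := Real.isLittleO_log_id_atTop.tendsto_div_nhds_zero
    simpa using this.abs
  have hlim := ((tendsto_inv_atTop_zero.const_mul A).add (hlog.const_mul M)).const_mul C
  simp only [mul_zero, add_zero] at hlim
  refine squeeze_zero_norm' ?_ hlim
  filter_upwards [eventually_gt_atTop 0] with t ht'
  have hP := P_nonneg (m + 1) (k + 1 : ℕ) ht'.le
  rw [norm_mul, Real.norm_eq_abs, Real.norm_eq_abs, abs_of_nonneg hP]
  calc _ ≤ (C * t⁻¹) * (A + M * |Real.log t|) :=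
        mul_le_mul (P_succ_le_div m k ht') (h t ht') (abs_nonneg _) (by positivity)
    _ = _ := by rw [abs_div, abs_of_pos ht']; ring

lemma v_eq (m k : ℕ) (g : ℝ → ℝ) :
    v (m + 1) k g = (m + 2) * (∫ t in Ioi (0 : ℝ), P (m + 3) ((k : ℤ) - 1) t * g t)
      + P (m + 2) k 0 * g 0 := by
  rcases k with _ | k
  · simp [v_zero, P_of_neg, P_zero_zero]
  · rw [v_succ, P_succ_zero, show ((k + 1 : ℕ) : ℤ) - 1 = (k : ℤ) by push_cast; ring]
    ring

lemma BddContOn.exists_measBdd {g : ℝ → ℝ} (hg : BddContOn g) : ∃ M, MeasBdd g M := by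
  obtain ⟨hc, M, hM⟩ := hg
  exact ⟨M, (hc.mono Ioi_subset_Ici_self).aestronglyMeasurable measurableSet_Ioi, hM⟩

lemma Dt_zero (g : ℝ → ℝ) : Dt g 0 = 0 := by simp [Dt, psi]

lemma measBdd_Dt {g : ℝ → ℝ} {M : ℝ} (hM : ∀ x, 0 ≤ x → |Dt g x| ≤ M) : MeasBdd (Dt g) M := by
  refine ⟨Measurable.aestronglyMeasurable ?_, hM⟩
  exact Measurable.mul (by unfold psi; fun_prop) (measurable_deriv _)

lemma MemW2.exists_measBdd {g : ℝ → ℝ} (hw : MemW2 g) : ∃ M, MeasBdd (Dt g) M := by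
  obtain ⟨-, -, M, hM⟩ := hw
  refine ⟨M, measBdd_Dt fun x hx => ?_⟩
  rcases hx.eq_or_lt with rfl | hx
  · rw [Dt_zero, abs_zero]; exact (abs_nonneg _).trans (hM 1 (by simp))
  · exact hM x hx

lemma v_Dt_succ {g : ℝ → ℝ} (hg : BddContOn g) (hw : MemW2 g) (m k : ℕ) :
    v (m + 1) (k + 1) (Dt g) = (k + 1) * (m + 2 + k) *
      (v (m + 1) (k + 2) g - 2 * v (m + 1) (k + 1) g + v (m + 1) k g) := by
  obtain ⟨M, hM⟩ := hg.exists_measBdd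
  obtain ⟨N, hN⟩ := hw.exists_measBdd
  have hd1 (t : ℝ) (ht : 0 < t) : HasDerivAt g (deriv g t) t :=
    (hw.1.differentiableAt (Ioi_mem_nhds ht)).hasDerivAt
  have hd2 (t : ℝ) (ht : 0 < t) : HasDerivAt (deriv g) (deriv (deriv g) t) t :=
    (hw.2.1.differentiableAt (Ioi_mem_nhds ht)).hasDerivAt
  set a : ℝ := (k + 1) * (m + 2 + k) with ha
  have ha0 : a ≠ 0 := by positivity
  set F : ℝ → ℝ := fun t => P (m + 1) (k + 1 : ℕ) t * deriv g t
    - (m + 1) * (P (m + 2) k t - P (m + 2) (k + 1 : ℕ) t) * g t with hF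
  set F' : ℝ → ℝ := fun t => (m + 1) * (m + 2) / a * (P (m + 3) k t * Dt g t)
    - ((m + 1) * (m + 2) * (P (m + 3) ((k : ℤ) - 1) t * g t)
      - 2 * (m + 1) * (m + 2) * (P (m + 3) k t * g t)
      + (m + 1) * (m + 2) * (P (m + 3) (k + 1 : ℕ) t * g t)) with hF'
  have hderiv (t : ℝ) (ht : t ∈ Ioi (0 : ℝ)) : HasDerivAt F (F' t) t := by
    have ht1 : -1 < t := by simp at ht; linarith
    have e1 : ((k + 1 : ℕ) : ℤ) - 1 = k := by push_cast; ring
    have h1 := hasDerivAt_P m (k + 1 : ℕ) ht1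
    have h2 := hasDerivAt_P (m + 1) k ht1
    have h3 := hasDerivAt_P (m + 1) (k + 1 : ℕ) ht1
    rw [e1] at h1 h3
    have h4 := (h1.mul (hd2 t ht)).sub (((h2.sub h3).const_mul ((m : ℝ) + 1)).mul (hd1 t ht))
    refine h4.congr_deriv ?_
    have h5 := psi_mul_P m k ht1
    have h6 : P (m + 1) (k + 1 : ℕ) t = (m + 1) * (m + 2) / a * (psi t * P (m + 3) k t) := by
      rw [div_mul_eq_mul_div, h5, ha]
      push_cast
      field_simp
    simp only [hF', Dt, Pi.sub_apply]
    rw [h6]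
    push_cast
    ring
  have i1 := hN.integrableOn (m + 1) k
  have i2 := hM.integrableOn (m + 1) ((k : ℤ) - 1)
  have i3 := hM.integrableOn (m + 1) k
  have i4 := hM.integrableOn (m + 1) (k + 1 : ℕ)
  have j1 := i1.const_mul (((m : ℝ) + 1) * (m + 2) / a)
  have j2 := i2.const_mul (((m : ℝ) + 1) * (m + 2))
  have j3 := i3.const_mul (2 * ((m : ℝ) + 1) * (m + 2))
  have j4 := i4.const_mul (((m : ℝ) + 1) * (m + 2))
  have hcont : ContinuousWithinAt F (Ici 0) 0 := by
    refine ContinuousWithinAt.sub ?_ (ContinuousWithinAt.mul ?_ (hg.1 0 (by simp)))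
    · rw [← continuousWithinAt_Ioi_iff_Ici, ContinuousWithinAt, P_succ_zero, zero_mul]
      exact hw.tendsto_P_mul_deriv_nhdsGT m k
    · have hc (j : ℤ) : ContinuousAt (P (m + 2) j) 0 :=
        (hasDerivAt_P (m + 1) j (by norm_num)).continuousAt
      exact (((hc _).sub (hc _)).const_mul _).continuousWithinAt
  have htop : Tendsto F atTop (nhds 0) := by
    have h1 := hw.tendsto_P_mul_deriv_atTop m k
    have h2 : Tendsto (fun t => (m + 1) * (P (m + 2) k t - P (m + 2) (k + 1 : ℕ) t) * g t)
        atTop (nhds 0) := by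
      have h3 := ((tendsto_P_atTop (m + 1) k).sub
        (tendsto_P_atTop (m + 1) (k + 1 : ℕ))).const_mul ((m : ℝ) + 1)
      rw [sub_zero, mul_zero] at h3
      refine h3.zero_mul_isBoundedUnder_le ⟨M, ?_⟩
      rw [eventually_map]
      filter_upwards [eventually_ge_atTop 0] with t ht using hM.le t ht
    have h3 := h1.sub h2
    rwa [sub_zero] at h3
  have key := integral_Ioi_of_hasDerivAt_of_tendsto hcont hderiv
    (j1.sub ((j2.sub j3).add j4)) htop
  have hF0 : F 0 = -((m + 1) * P (m + 2) k 0 * g 0) := by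
    simp only [hF, P_succ_zero m k, P_succ_zero (m + 1) k]
    ring
  have hI := integral_sub j1 ((j2.sub j3).add j4)
  rw [integral_add' (j2.sub j3) j4, integral_sub' j2 j3, integral_const_mul, integral_const_mul,
    integral_const_mul, integral_const_mul] at hI
  rw [hF0] at key
  replace key := hI.symm.trans key
  rw [v_succ, v_succ, v_succ, v_eq m k]
  have hm : ((m : ℝ) + 1) ≠ 0 := by positivity
  field_simp at key
  refine mul_left_cancel₀ hm ?_
  linear_combination key

lemma HasSum.of_forall_eq {u w : ℕ → ℝ} {a : ℝ} (h : HasSum u a) (e : ∀ k, w k = u k) :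
    HasSum w a := by
  rwa [funext e]

lemma Summable.bdd_mul_nonneg {u s : ℕ → ℝ} {M : ℝ} (hs : Summable s) (hs0 : ∀ k, 0 ≤ s k)
    (hu : ∀ k, |u k| ≤ M) : Summable fun k => u k * s k := by
  refine Summable.of_norm_bounded (hs.mul_left M) fun k => ?_
  rw [norm_mul, Real.norm_eq_abs, Real.norm_eq_abs, abs_of_nonneg (hs0 k)]
  exact mul_le_mul_of_nonneg_right (hu k) (hs0 k)

lemma MeasBdd.summable_v_mul_P {g : ℝ → ℝ} {M : ℝ} (hg : MeasBdd g M) (m : ℕ) {x : ℝ}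
    (hx : 0 ≤ x) : Summable fun k : ℕ => v (m + 1) k g * P (m + 1) k x :=
  (hasSum_P m hx).summable.bdd_mul_nonneg (fun _ => P_nonneg _ _ hx) (hg.abs_v_le m)

lemma MeasBdd.hasSum_V {g : ℝ → ℝ} {M : ℝ} (hg : MeasBdd g M) (m : ℕ) {x : ℝ}
    (hx : 0 ≤ x) : HasSum (fun k : ℕ => v (m + 1) k g * P (m + 1) k x) (V (m + 1) g x) :=
  (hg.summable_v_mul_P m hx).hasSum

lemma MeasBdd.abs_V_le {g : ℝ → ℝ} {M : ℝ} (hg : MeasBdd g M) (m : ℕ) {x : ℝ}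
    (hx : 0 ≤ x) : |V (m + 1) g x| ≤ M := by
  have h := (hasSum_P m hx).mul_left M
  rw [mul_one] at h
  rw [← Real.norm_eq_abs]
  refine (hg.hasSum_V m hx).norm_le_of_bounded h fun k => ?_
  rw [norm_mul, Real.norm_eq_abs, Real.norm_eq_abs, abs_of_nonneg (P_nonneg (m + 1) k hx)]
  exact mul_le_mul_of_nonneg_right (hg.abs_v_le m k) (P_nonneg _ _ hx)

lemma summable_weight_mul_P (m : ℕ) {x : ℝ} (hx : 0 ≤ x) :
    Summable fun k : ℕ => (k : ℝ) * (m + 1 + k) * P (m + 1) k x := by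
  refine ((hasSum_natCast_mul_succ_mul_P m hx).summable.add
    ((hasSum_natCast_mul_P m hx).summable.mul_left (m : ℝ))).congr fun k => ?_
  ring

lemma V_sub_V_succ {g : ℝ → ℝ} (hg : BddContOn g) (hw : MemW2 g) (m : ℕ) {x : ℝ} (hx : 0 ≤ x) :
    V (m + 1) g x - V (m + 2) g x = 1 / ((m + 1) * (m + 2)) * V (m + 1) (Dt g) x := by
  obtain ⟨M, hM⟩ := hg.exists_measBdd
  obtain ⟨N, hN⟩ := hw.exists_measBdd
  have hx1 : -1 < x := by linarith
  have hP := hasSum_P m hx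
  have hkP := hasSum_natCast_mul_P m hx
  have hP0 (k : ℕ) := P_nonneg (m + 1) k hx
  have hA : Summable fun k : ℕ => v (m + 2) k g * ((m + 1 + k) * P (m + 1) k x) := by
    refine Summable.bdd_mul_nonneg ?_ (fun k => mul_nonneg (by positivity) (hP0 k))
      (hM.abs_v_le (m + 1))
    refine ((hP.summable.mul_left ((m : ℝ) + 1)).add hkP.summable).congr fun k => ?_
    ring
  have hB : Summable fun k : ℕ => v (m + 2) (k - 1) g * (k * P (m + 1) k x) :=
    hkP.summable.bdd_mul_nonneg (fun k => mul_nonneg (by positivity) (hP0 k))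
      (fun k => hM.abs_v_le (m + 1) (k - 1))
  obtain ⟨SA, hA⟩ := hA
  obtain ⟨SB, hB⟩ := hB
  have hB' := (hasSum_nat_add_iff' 1).2 hB
  simp only [Finset.range_one, Finset.sum_singleton, Nat.cast_zero, zero_mul, mul_zero,
    sub_zero, Nat.add_sub_cancel] at hB'
  have h1 : HasSum (fun k : ℕ => ((m : ℝ) + 1) * (v (m + 2) k g * P (m + 2) k x))
      ((m + 1) * V (m + 2) g x) := (hM.hasSum_V (m + 1) hx).mul_left _
  have h2 := hA.sub hB'
  have h3 : ((m : ℝ) + 1) * V (m + 2) g x = SA - SB := by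
    refine h1.unique (HasSum.of_forall_eq h2 fun k => ?_)
    have := P_succ_eq m k hx1
    push_cast at this ⊢
    linear_combination v (m + 2) k g * this
  have h4 := (((hM.hasSum_V m hx).mul_left (((m : ℝ) + 1) * (m + 2))).sub (hN.hasSum_V m hx))
  have h5 : ((m : ℝ) + 2) * ((m + 1) * V (m + 2) g x)
      = (m + 1) * (m + 2) * V (m + 1) g x - V (m + 1) (Dt g) x := by
    rw [h3]
    refine HasSum.unique ((hA.sub hB).mul_left ((m : ℝ) + 2)) (h4.of_forall_eq fun k => ?_)
    rcases k with _ | k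
    · simp [v_zero, Dt_zero]; ring
    · rw [v_Dt_succ hg hw]
      have e1 := hM.v_succ_left m (k + 1)
      have e2 := hM.v_succ_left m k
      simp only [Nat.add_sub_cancel]
      push_cast at e1 e2 ⊢
      linear_combination (m + 1 + (k + 1)) * P (m + 1) ((k : ℤ) + 1) x * e1
        - (k + 1) * P (m + 1) ((k : ℤ) + 1) x * e2
  field_simp
  linear_combination -h5

lemma Vt_eq {g : ℝ → ℝ} (hg : BddContOn g) (hw : MemW2 g) (m : ℕ) {x : ℝ} (hx : 0 ≤ x) :
    Vt (m + 1) g x = V (m + 1) g x - 1 / (m + 1) * V (m + 1) (Dt g) x := by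
  obtain ⟨M, hM⟩ := hg.exists_measBdd
  obtain ⟨N, hN⟩ := hw.exists_measBdd
  have hx1 : -1 < x := by linarith
  have hs := summable_weight_mul_P m hx
  have hs0 (k : ℕ) : 0 ≤ (k : ℝ) * (m + 1 + k) * P (m + 1) k x :=
    mul_nonneg (by positivity) (P_nonneg _ _ hx)
  have hL := (hs.bdd_mul_nonneg hs0 (fun k => hM.abs_v_le m (k + 1))).hasSum
  have hC := (hs.bdd_mul_nonneg hs0 (hM.abs_v_le m)).hasSum
  have hR := (hs.bdd_mul_nonneg hs0 (fun k => hM.abs_v_le m (k - 1))).hasSum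
  have hR' := (hasSum_nat_add_iff' 1).2 hR
  simp only [Finset.range_one, Finset.sum_singleton, Nat.cast_zero, zero_mul, mul_zero,
    sub_zero, Nat.add_sub_cancel] at hR'
  have hL' : HasSum (fun k : ℕ => v (m + 1) k g * ((k - 1) * (m + k) * P (m + 1) ((k : ℤ) - 1) x))
      (∑' k : ℕ, v (m + 1) (k + 1) g * (k * (m + 1 + k) * P (m + 1) k x)) := by
    rw [← hasSum_nat_add_iff' 1]
    simp only [Finset.range_one, Finset.sum_singleton]
    rw [P_of_neg (m + 1) (show ((0 : ℕ) : ℤ) - 1 < 0 by norm_num), mul_zero, mul_zero, sub_zero]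
    refine hL.of_forall_eq fun k => ?_
    rw [show ((k + 1 : ℕ) : ℤ) - 1 = k by push_cast; ring]
    push_cast
    ring
  have h1 : HasSum (fun k : ℕ => v (m + 1) k g * Dt (P (m + 1) k) x) (V (m + 1) (Dt g) x) := by
    have h2 := (hL'.sub (hC.mul_left 2)).add hR'
    have h3 : HasSum (fun k : ℕ => v (m + 1) k g * Dt (P (m + 1) k) x) _ :=
      h2.of_forall_eq fun k => by
        rw [Dt_P m k hx1]
        push_cast
        ring
    convert h3
    refine (hN.hasSum_V m hx).unique (((hL.sub (hC.mul_left 2)).add hR).of_forall_eq fun k => ?_)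
    rcases k with _ | k
    · simp [v_zero, Dt_zero]
    · rw [v_Dt_succ hg hw]
      simp only [Nat.add_sub_cancel]
      push_cast
      ring
  have h2 := ((hM.hasSum_V m hx).sub (h1.mul_left (1 / ((m : ℝ) + 1))))
  rw [← h2.tsum_eq, Vt]
  refine tsum_congr fun k => ?_
  push_cast
  ring

lemma MeasBdd.abs_v_sub_le {g : ℝ → ℝ} {M : ℝ} (hg : MeasBdd g M) {x y ε C : ℝ}
    (h : ∀ t, 0 ≤ t → |g t - y| ≤ ε + C * (t - x) ^ 2) (l k : ℕ) :
    |v (l + 2) k g - y| ≤ ε + C * x ^ 2 - 2 * C * x / (l + 2) * k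
      + C / ((l + 1) * (l + 2)) * (k * (k + 1)) := by
  rcases k with _ | k
  · have := h 0 le_rfl
    rw [v_zero]
    simpa using this
  · have i0 := integrableOn_P (l + 2) k
    have i1 := (integrableOn_P (l + 1) (k + 1 : ℕ)).const_mul (2 * C * x * (k + 1) / (l + 3))
    have i2 := (integrableOn_P l (k + 2 : ℕ)).const_mul
      (C * ((k + 1) * (k + 2)) / ((l + 2) * (l + 3)))
    have i0' := i0.const_mul (ε + C * x ^ 2)
    have hv : v (l + 2) (k + 1) g - y = ∫ t in Ioi (0 : ℝ), (l + 3) * (P (l + 4) k t * (g t - y)) := by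
      have h1 := integral_sub (hg.integrableOn (l + 2) k) (i0.mul_const y)
      rw [integral_mul_const, integral_P (l + 2) k] at h1
      simp only [← mul_sub] at h1
      rw [integral_const_mul, h1, v_succ (l + 1) k g]
      push_cast
      field_simp
      ring
    have hI := integral_add (i0'.sub i1) i2
    rw [integral_sub' i0' i1, integral_const_mul, integral_const_mul, integral_const_mul,
      integral_P, integral_P, integral_P] at hI
    rw [hv, ← Real.norm_eq_abs]
    refine (norm_integral_le_of_norm_le (((i0'.sub i1).add i2).const_mul ((l : ℝ) + 3)) ?_).trans ?_
    · filter_upwards [ae_restrict_mem measurableSet_Ioi] with t ht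
      have ht0 : 0 ≤ t := le_of_lt ht
      have h0 := P_nonneg (l + 4) k ht0
      rw [norm_mul, norm_mul, Real.norm_eq_abs, Real.norm_eq_abs, Real.norm_eq_abs,
        abs_of_nonneg h0, abs_of_nonneg (by positivity : (0 : ℝ) ≤ l + 3)]
      refine mul_le_mul_of_nonneg_left ?_ (by positivity)
      refine (mul_le_mul_of_nonneg_left (h t ht0) h0).trans_eq ?_
      have e1 := mul_P_succ (l + 2) k t
      have e2 := mul_P_succ (l + 1) (k + 1) t
      rw [show (k : ℤ) + 1 + 1 = k + 2 by ring] at e2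
      push_cast at e1 e2
      simp only [Pi.add_apply, Pi.sub_apply]
      have e1' : P (l + 3) (k + 1 : ℕ) t = (l + 3) / (k + 1) * (t * P (l + 4) k t) := by
        push_cast
        field_simp
        linear_combination -e1
      have e2' : P (l + 2) (k + 2 : ℕ) t
          = (l + 2) * (l + 3) / ((k + 1) * (k + 2)) * (t ^ 2 * P (l + 4) k t) := by
        push_cast
        field_simp
        linear_combination -(k + 1 : ℝ) * e2 - (l + 2) * t * e1
      rw [e1', e2']
      field_simp
      ring
    · rw [integral_const_mul]
      refine (congrArg (((l : ℝ) + 3) * ·) hI).trans_le (le_of_eq ?_)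
      push_cast
      field_simp
      ring

lemma MeasBdd.abs_V_sub_le {g : ℝ → ℝ} {M : ℝ} (hg : MeasBdd g M) {x y ε C : ℝ} (hx : 0 ≤ x)
    (h : ∀ t, 0 ≤ t → |g t - y| ≤ ε + C * (t - x) ^ 2) (l : ℕ) :
    |V (l + 2) g x - y| ≤ ε + 2 * C * (x * (1 + x)) / (l + 1) := by
  have hP := hasSum_P (l + 1) hx
  have h1 := (hg.hasSum_V (l + 1) hx).sub (hP.mul_left y)
  have h2 := ((hP.mul_left (ε + C * x ^ 2)).sub ((hasSum_natCast_mul_P (l + 1) hx).mul_left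
    (2 * C * x / (l + 2)))).add ((hasSum_natCast_mul_succ_mul_P (l + 1) hx).mul_left
    (C / ((l + 1) * (l + 2))))
  have h3 := h1.norm_le_of_bounded h2 fun k => by
    have h0 := P_nonneg (l + 2) k hx
    rw [← sub_mul, norm_mul, Real.norm_eq_abs, Real.norm_eq_abs, abs_of_nonneg h0]
    refine (mul_le_mul_of_nonneg_right (hg.abs_v_sub_le h l k) h0).trans_eq ?_
    ring
  rw [mul_one, Real.norm_eq_abs] at h3
  refine h3.trans_eq ?_
  push_cast
  field_simp
  ring

lemma BddContOn.exists_quadratic_bound {g : ℝ → ℝ} (hg : BddContOn g) {x ε : ℝ} (hx : 0 ≤ x)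
    (hε : 0 < ε) : ∃ C : ℝ, ∀ t, 0 ≤ t → |g t - g x| ≤ ε + C * (t - x) ^ 2 := by
  obtain ⟨hc, M, hM⟩ := hg
  obtain ⟨δ, hδ, hδ'⟩ := Metric.continuousWithinAt_iff.1 (hc x hx) ε hε
  have hM0 : 0 ≤ M := (abs_nonneg _).trans (hM x hx)
  refine ⟨2 * M / δ ^ 2, fun t ht => ?_⟩
  rcases lt_or_ge (dist t x) δ with h | h
  · have h1 := hδ' ht h
    rw [Real.dist_eq] at h1
    have : 0 ≤ 2 * M / δ ^ 2 * (t - x) ^ 2 := by positivity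
    linarith
  · rw [Real.dist_eq] at h
    have h1 : δ ^ 2 ≤ (t - x) ^ 2 := by
      rw [← sq_abs (t - x)]
      gcongr
    have h2 : 2 * M ≤ 2 * M / δ ^ 2 * (t - x) ^ 2 := by
      rw [div_mul_eq_mul_div, le_div_iff₀ (by positivity)]
      gcongr
    have h3 := abs_sub (g t) (g x)
    have h4 := hM t ht
    have h5 := hM x hx
    linarith

lemma BddContOn.tendsto_V {g : ℝ → ℝ} (hg : BddContOn g) {x : ℝ} (hx : 0 ≤ x) :
    Tendsto (fun m : ℕ => V (m + 1) g x) atTop (nhds (g x)) := by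
  obtain ⟨M, hM⟩ := hg.exists_measBdd
  rw [← tendsto_add_atTop_iff_nat 1, Metric.tendsto_atTop']
  intro ε hε
  obtain ⟨C, hC⟩ := hg.exists_quadratic_bound hx (half_pos hε)
  have hlim : Tendsto (fun l : ℕ => ε / 2 + 2 * C * (x * (1 + x)) * (1 / ((l : ℝ) + 1))) atTop
      (nhds (ε / 2)) := by
    simpa using (tendsto_one_div_add_atTop_nhds_zero_nat.const_mul
      (2 * C * (x * (1 + x)))).const_add (ε / 2)
  obtain ⟨L, hL⟩ := eventually_atTop.1 (hlim.eventually_lt_const (half_lt_self hε))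
  refine ⟨L, fun l hl => ?_⟩
  rw [Real.dist_eq]
  refine (hM.abs_V_sub_le hx hC l).trans_lt ?_
  have := hL l hl.le
  rwa [mul_one_div] at this

lemma abs_V_sub_self_le {g : ℝ → ℝ} {N : ℝ} (hg : BddContOn g) (hw : MemW2 g)
    (hN : MeasBdd (Dt g) N) (m : ℕ) {x : ℝ} (hx : 0 ≤ x) :
    |V (m + 1) g x - g x| ≤ N / (m + 1) := by
  have hpart (j : ℕ) : |V (m + 1) g x - V (m + j + 1) g x|
      ≤ N * (1 / ((m : ℝ) + 1) - 1 / (m + j + 1)) := by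
    induction j with
    | zero => simp
    | succ j ih =>
      have h1 := V_sub_V_succ hg hw (m + j) hx
      have h2 := hN.abs_V_le (m + j) hx
      rw [show V (m + 1) g x - V (m + (j + 1) + 1) g x
        = (V (m + 1) g x - V (m + j + 1) g x) + (V (m + j + 1) g x - V (m + j + 2) g x) by
          rw [show m + (j + 1) + 1 = m + j + 2 by ring]; ring]
      refine (abs_add_le _ _).trans ?_
      rw [h1, abs_mul]
      push_cast
      rw [abs_of_nonneg (by positivity : (0 : ℝ) ≤ 1 / ((m + j + 1) * (m + j + 2)))]
      have h3 : 1 / (((m : ℝ) + j + 1) * (m + j + 2)) * |V (m + j + 1) (Dt g) x|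
          ≤ 1 / ((m + j + 1) * (m + j + 2)) * N := by gcongr
      have h4 : 1 / (((m : ℝ) + j + 1) * (m + j + 2))
          = 1 / (m + j + 1) - 1 / (m + (j + 1) + 1) := by
        field_simp
        ring
      rw [h4] at h3 ⊢
      linarith
  have hlim : Tendsto (fun j : ℕ => |V (m + 1) g x - V (m + j + 1) g x|) atTop
      (nhds |V (m + 1) g x - g x|) := by
    have := (tendsto_add_atTop_iff_nat m).2 (hg.tendsto_V hx)
    simp only [add_comm _ m] at this
    exact (tendsto_const_nhds.sub this).abs
  refine le_of_tendsto hlim (Eventually.of_forall fun j => (hpart j).trans ?_)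
  rw [div_eq_mul_one_div N]
  refine mul_le_mul_of_nonneg_left ?_ hN.nonneg
  have : (0 : ℝ) ≤ 1 / (m + j + 1) := by positivity
  linarith

lemma Vt_sub_Vt_succ {f : ℝ → ℝ} (hf : BddContOn f) (hw : MemW2 f) (hDf : BddContOn (Dt f))
    (hDw : MemW2 (Dt f)) (m : ℕ) {x : ℝ} (hx : 0 ≤ x) :
    Vt (m + 1) f x - Vt (m + 2) f x
      = -(1 / ((m + 1) * (m + 2) ^ 2) * V (m + 1) (Dt (Dt f)) x) := by
  have h1 := V_sub_V_succ hf hw m hx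
  have h2 := V_sub_V_succ hDf hDw m hx
  have h3 := Vt_eq hf hw (m + 1) hx
  push_cast at h3
  rw [Vt_eq hf hw m hx, h3]
  have h4 : 1 / (((m : ℝ) + 1) * (m + 2)) = 1 / (m + 1) - 1 / (m + 1 + 1) := by
    field_simp
    ring
  have h5 : 1 / (((m : ℝ) + 1) * (m + 2) ^ 2)
      = 1 / (m + 1 + 1) * (1 / ((m + 1) * (m + 2))) := by
    field_simp
    ring
  rw [h4] at h1
  rw [h5]
  linear_combination h1 - 1 / ((m : ℝ) + 1 + 1) * h2

lemma BddContOn.tendsto_Vt {f : ℝ → ℝ} (hf : BddContOn f) (hw : MemW2 f) {x : ℝ} (hx : 0 ≤ x) :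
    Tendsto (fun m : ℕ => Vt (m + 1) f x) atTop (nhds (f x)) := by
  obtain ⟨N, hN⟩ := hw.exists_measBdd
  have h1 : Tendsto (fun m : ℕ => 1 / ((m : ℝ) + 1) * V (m + 1) (Dt f) x) atTop (nhds 0) :=
    tendsto_one_div_add_atTop_nhds_zero_nat.zero_mul_isBoundedUnder_le
      ⟨N, by simpa using ⟨0, fun m _ => hN.abs_V_le m hx⟩⟩
  have h2 := (hf.tendsto_V hx).sub h1
  rw [sub_zero] at h2
  exact h2.congr fun m => (Vt_eq hf hw m hx).symm

lemma MemW20.bddContOn_Dt {f : ℝ → ℝ} (hf : MemW20 f) (hD : MemW2 (Dt f)) : BddContOn (Dt f) := by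
  obtain ⟨N, hN⟩ := hf.1.exists_measBdd
  refine ⟨fun x hx => ?_, N, hN.le⟩
  rcases (show (0 : ℝ) ≤ x from hx).eq_or_lt with rfl | hx
  · rw [← continuousWithinAt_Ioi_iff_Ici, ContinuousWithinAt, Dt_zero]
    exact hf.2
  · exact (hD.1.differentiableAt (Ioi_mem_nhds hx)).continuousAt.continuousWithinAt

lemma MeasBdd.abs_le_supNorm {g : ℝ → ℝ} {M : ℝ} (hg : MeasBdd g M) {x : ℝ} (hx : 0 ≤ x) :
    |g x| ≤ supNorm g := by
  have hb : BddAbove (range fun x => ⨆ _ : x ∈ Ici (0 : ℝ), |g x|) := by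
    refine ⟨M, ?_⟩
    rintro _ ⟨y, rfl⟩
    exact Real.iSup_le (fun hy => hg.le y hy) hg.nonneg
  refine le_trans ?_ (le_ciSup hb x)
  exact (ciSup_pos (f := fun _ => |g x|) (show x ∈ Ici (0 : ℝ) from hx)).ge

lemma supNorm_nonneg (g : ℝ → ℝ) : 0 ≤ supNorm g :=
  Real.iSup_nonneg fun _ => Real.iSup_nonneg fun _ => abs_nonneg _

lemma supNorm_le {g : ℝ → ℝ} {R : ℝ} (hR : 0 ≤ R) (h : ∀ x, 0 ≤ x → |g x| ≤ R) :
    supNorm g ≤ R :=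
  Real.iSup_le (fun x => Real.iSup_le (fun hx => h x hx) hR) hR

lemma summable_one_div_sq (m : ℕ) : Summable fun j : ℕ => 1 / ((m : ℝ) + 1 + j) ^ 2 := by
  have h := (summable_nat_add_iff (m + 1)).2 (Real.summable_one_div_nat_pow.2 one_lt_two)
  refine h.congr fun j => ?_
  push_cast
  ring

lemma summable_lambda (m : ℕ) :
    Summable fun j : ℕ => 1 / (((m : ℝ) + 1 + j) * ((m : ℝ) + 1 + j + 1) ^ 2) := by
  refine (summable_one_div_sq m).of_nonneg_of_le (fun j => by positivity) fun j => ?_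
  gcongr 1 / ?_
  have h0 : (0 : ℝ) ≤ m := by positivity
  have h1 : (0 : ℝ) ≤ j := by positivity
  nlinarith [mul_nonneg h0 h1, mul_nonneg (mul_nonneg h0 h0) h1, pow_nonneg (add_nonneg h0 h1) 3]

lemma summable_theta (m : ℕ) :
    Summable fun j : ℕ => 1 / (((m : ℝ) + 1 + j) ^ 2 * ((m : ℝ) + 1 + j + 1) ^ 2) := by
  refine (summable_one_div_sq m).of_nonneg_of_le (fun j => by positivity) fun j => ?_
  gcongr 1 / ?_
  refine le_mul_of_one_le_right (by positivity) (one_le_pow₀ ?_)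
  have h0 : (0 : ℝ) ≤ m := by positivity
  have h1 : (0 : ℝ) ≤ j := by positivity
  linarith

lemma abs_Vt_sub_add_le {f : ℝ → ℝ} (hf : BddContOn f) (hfW : MemW20 f) (hDfW : MemW20 (Dt f))
    (hD2fW : MemW2 (Dt (Dt f))) (m : ℕ) {x : ℝ} (hx : 0 ≤ x) :
    |Vt (m + 1) f x - f x
        + (∑' j : ℕ, 1 / (((m : ℝ) + 1 + j) * ((m : ℝ) + 1 + j + 1) ^ 2)) * Dt (Dt f) x|
      ≤ (∑' j : ℕ, 1 / (((m : ℝ) + 1 + j) ^ 2 * ((m : ℝ) + 1 + j + 1) ^ 2))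
          * supNorm (Dt (Dt (Dt f))) := by
  have hDf := hfW.bddContOn_Dt hDfW.1
  have hD2f := hDfW.bddContOn_Dt hD2fW
  obtain ⟨N, hN⟩ := hD2fW.exists_measBdd
  set K := supNorm (Dt (Dt (Dt f))) with hK
  have hKb : MeasBdd (Dt (Dt (Dt f))) K := ⟨hN.meas, fun x hx => hN.abs_le_supNorm hx⟩
  set c : ℕ → ℝ := fun j => 1 / (((m : ℝ) + 1 + j) * ((m : ℝ) + 1 + j + 1) ^ 2) with hc
  set d : ℕ → ℝ := fun j => 1 / (((m : ℝ) + 1 + j) ^ 2 * ((m : ℝ) + 1 + j + 1) ^ 2) with hd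
  have hpart (J : ℕ) : |Vt (m + 1) f x - Vt (m + J + 1) f x
      + (∑ j ∈ Finset.range J, c j) * Dt (Dt f) x| ≤ (∑ j ∈ Finset.range J, d j) * K := by
    induction J with
    | zero => simp
    | succ J ih =>
      have h1 := Vt_sub_Vt_succ hf hfW.1 hDf hDfW.1 (m + J) hx
      have h2 := abs_V_sub_self_le hD2f hD2fW hKb (m + J) hx
      have hc0 : 0 ≤ c J := by positivity
      have e : Vt (m + 1) f x - Vt (m + (J + 1) + 1) f x
          + (∑ j ∈ Finset.range (J + 1), c j) * Dt (Dt f) x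
          = (Vt (m + 1) f x - Vt (m + J + 1) f x + (∑ j ∈ Finset.range J, c j) * Dt (Dt f) x)
            + -(c J * (V (m + J + 1) (Dt (Dt f)) x - Dt (Dt f) x)) := by
        have hcJ : c J = 1 / (((m + J : ℕ) + 1 : ℝ) * ((m + J : ℕ) + 2) ^ 2) := by
          simp only [hc]
          push_cast
          congr 1
          ring
        rw [← hcJ] at h1
        rw [Finset.sum_range_succ, show m + (J + 1) + 1 = m + J + 2 by ring]
        linear_combination h1
      rw [e, Finset.sum_range_succ, add_mul]
      refine (abs_add_le _ _).trans (add_le_add ih ?_)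
      rw [abs_neg, abs_mul, abs_of_nonneg hc0]
      refine (mul_le_mul_of_nonneg_left h2 hc0).trans_eq ?_
      simp only [hc, hd]
      push_cast
      field_simp
      ring
  have hlim := (((tendsto_const_nhds (x := Vt (m + 1) f x)).sub
    ((tendsto_add_atTop_iff_nat m).2 (hf.tendsto_Vt hfW.1 hx))).add
    ((summable_lambda m).hasSum.tendsto_sum_nat.mul_const (Dt (Dt f) x))).abs
  refine le_of_tendsto_of_tendsto' hlim
    ((summable_theta m).hasSum.tendsto_sum_nat.mul_const K) fun J => ?_
  rw [add_comm J m]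
  exact hpart J

theorem voronovskaya_type_inequality (n : ℕ) (hn : 2 ≤ n) (f : ℝ → ℝ) (hf : BddContOn f)
    (hfW : MemW20 f) (hDfW : MemW20 (Dt f)) (hD2fW : MemW2 (Dt (Dt f))) :
    supNorm (fun x => Vt n f x - f x
        + (∑' j : ℕ, 1 / (((n : ℝ) + (j : ℝ)) * ((n : ℝ) + (j : ℝ) + 1) ^ 2)) * Dt (Dt f) x)
      ≤ (∑' j : ℕ, 1 / (((n : ℝ) + (j : ℝ)) ^ 2 * ((n : ℝ) + (j : ℝ) + 1) ^ 2))
          * supNorm (Dt (Dt (Dt f))) := by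
  obtain ⟨m, rfl⟩ := Nat.exists_eq_add_of_le' (one_le_two.trans hn)
  refine supNorm_le (mul_nonneg (tsum_nonneg fun j => by positivity) (supNorm_nonneg _))
    fun x hx => ?_
  have h := abs_Vt_sub_add_le hf hfW hDfW hD2fW m hx
  push_cast
  exact h
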